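/- Let λ, μ, ν be partitions of n and suppose A ∈ M(λ,μ) has π-sequence ν, is minimal, and is π-unique (the only matrix in M(λ,μ) with π-sequence ν). Then χ^ν is a minimal component of χ^λ ⊗ χ^μ, the Kronecker coefficient k(λ,μ,ν) = 1, and k(α,β,γ) = 0 for every triple (α,β,γ) ≠ (λ,μ,ν) with α ⊵ λ, β ⊵ μ, and γ ⊴ ν. -/

import Mathlib

open Finset Equiv
open scoped Classical

noncomputable section

/-- Value at `g` of the permutation character of `S_n` induced from the trivial character of
the Young subgroup of the composition `c`: the number of colorings of `Fin n` with fiber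
sizes given by `c` that are fixed by `g`. -/
def permChar (n : ℕ) (c : ℕ → ℕ) (g : Perm (Fin n)) : ℚ :=
  Nat.card {f : Fin n → ℕ // (∀ k, Nat.card {x : Fin n // f x = k} = c k) ∧ ∀ x, f (g x) = f x}

/-- Inner product of class functions (real-valued characters) of `S_n`. -/
def innerChar (n : ℕ) (χ ψ : Perm (Fin n) → ℚ) : ℚ :=
  (∑ g : Perm (Fin n), χ g * ψ g) / (n.factorial : ℚ)

/-- The trivial character `χ^{(n)}` of `S_n`. -/
def trivChar (n : ℕ) : Perm (Fin n) → ℚ := fun _ => 1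

/-- The sign character `χ^{(1^n)}` of `S_n`. -/
def signChar (n : ℕ) : Perm (Fin n) → ℚ := fun g => ((Perm.sign g : ℤ) : ℚ)

/-- Permutation character for an integer vector: zero if some entry is negative. -/
def permCharZ (n : ℕ) (c : ℕ → ℤ) (g : Perm (Fin n)) : ℚ :=
  if ∀ k, 0 ≤ c k then permChar n (fun k => (c k).toNat) g else 0

/-- The irreducible character `χ^a` of `S_n` indexed by the partition `a`, given by the
Jacobi–Trudi determinantal formula `χ^a = ∑_σ sgn(σ) φ^{(a_i - i + σ(i))_i}`. -/
def irrChar (n : ℕ) (a : ℕ → ℕ) (g : Perm (Fin n)) : ℚ :=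
  ∑ σ : Perm (Fin n), ((Perm.sign σ : ℤ) : ℚ) *
    permCharZ n (fun i => if h : i < n then (a i : ℤ) - i + ((σ ⟨i, h⟩ : Fin n) : ℕ) else 0) g

/-- Kronecker coefficient `k(a,b,c) = ⟨χ^a ⊗ χ^b, χ^c⟩`. -/
def kron (n : ℕ) (a b c : ℕ → ℕ) : ℚ :=
  innerChar n (fun g => irrChar n a g * irrChar n b g) (irrChar n c)

/-- Extend a vector indexed by `Fin p` to `ℕ` by zeros. -/
def extc {p : ℕ} (l : Fin p → ℕ) : ℕ → ℕ := fun i => if h : i < p then l ⟨i, h⟩ else 0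

/-- Dominance order: `a ⊵ b`. -/
def Dominates (a b : ℕ → ℕ) : Prop :=
  ∀ k, ∑ i ∈ Finset.range k, b i ≤ ∑ i ∈ Finset.range k, a i

/-- Conjugate (transpose) of a partition with at most `n` parts. -/
def conjFun (n : ℕ) (a : ℕ → ℕ) : ℕ → ℕ :=
  fun j => ((Finset.range n).filter (fun i => j < a i)).card

/-- `a` is a partition of `n` (weakly decreasing, supported on the first `n` parts). -/
def IsPartitionFun (n : ℕ) (a : ℕ → ℕ) : Prop :=
  (∀ i j, i ≤ j → a j ≤ a i) ∧ (∀ i, n ≤ i → a i = 0) ∧ ∑ i ∈ Finset.range n, a i = n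

/-- The weakly decreasing sequence of parts of `P : Nat.Partition n`. -/
def pf {n : ℕ} (P : n.Partition) : ℕ → ℕ :=
  fun i => ((P.parts.sort (· ≤ ·)).reverse).getD i 0

/-- The parts of `P : Nat.Partition n` as a vector of length `n`. -/
def pfin {n : ℕ} (P : n.Partition) : Fin n → ℕ := fun k => pf P k

/-- Number of cells of the skew shape `a/b` where the filling `T` has entry `k`. -/
def skewContent (a b : ℕ → ℕ) (T : ℕ → ℕ → ℕ) (k : ℕ) : ℕ :=
  Nat.card {p : ℕ × ℕ // b p.1 ≤ p.2 ∧ p.2 < a p.1 ∧ T p.1 p.2 = k}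

/-- Number of cells of the skew shape `a/b`. -/
def skewSize (a b : ℕ → ℕ) : ℕ :=
  Nat.card {p : ℕ × ℕ // b p.1 ≤ p.2 ∧ p.2 < a p.1}

/-- `T` is a semistandard filling of the shape `a` (zero outside, rows weakly increasing,
columns strictly increasing). -/
def IsSSYT (a : ℕ → ℕ) (T : ℕ → ℕ → ℕ) : Prop :=
  (∀ i j, a i ≤ j → T i j = 0) ∧
  (∀ i j₁ j₂, j₁ ≤ j₂ → j₂ < a i → T i j₁ ≤ T i j₂) ∧
  (∀ i₁ i₂ j, i₁ < i₂ → j < a i₂ → T i₁ j < T i₂ j)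

/-- The Kostka number: the number of semistandard Young tableaux of shape `a`
and content `c`. -/
def kostka (a c : ℕ → ℕ) : ℕ :=
  Nat.card {T : ℕ → ℕ → ℕ // IsSSYT a T ∧ ∀ k, skewContent a (fun _ => 0) T k = c k}

/-- Number of entries equal to `k` in the prefix of the (right-to-left, top-to-bottom)
reading word of `T` ending at position `(i,j)`. -/
def lrCount (a b : ℕ → ℕ) (T : ℕ → ℕ → ℕ) (i j k : ℕ) : ℕ :=
  Nat.card {p : ℕ × ℕ //
    (p.1 < i ∨ (p.1 = i ∧ j ≤ p.2)) ∧ b p.1 ≤ p.2 ∧ p.2 < a p.1 ∧ T p.1 p.2 = k}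

/-- `T` is a Littlewood–Richardson skew tableau of shape `a/b`: semistandard and its
reverse reading word is a lattice word. -/
def IsLR (a b : ℕ → ℕ) (T : ℕ → ℕ → ℕ) : Prop :=
  (∀ i j, ¬(b i ≤ j ∧ j < a i) → T i j = 0) ∧
  (∀ i j₁ j₂, b i ≤ j₁ → j₁ ≤ j₂ → j₂ < a i → T i j₁ ≤ T i j₂) ∧
  (∀ i₁ i₂ j, i₁ < i₂ → b i₁ ≤ j → j < a i₁ → b i₂ ≤ j → j < a i₂ → T i₁ j < T i₂ j) ∧
  (∀ i j k, lrCount a b T i j (k + 1) ≤ lrCount a b T i j k)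

/-- A Littlewood–Richardson multitableau of shape `α` with `r` parts: a chain of
partitions `0 = α(0) ⊆ α(1) ⊆ ⋯ ⊆ α(r) = α` together with Littlewood–Richardson
fillings of the successive skew shapes. -/
structure LRMultiF (r : ℕ) (α : ℕ → ℕ) where
  chain : Fin (r + 1) → ℕ → ℕ
  antitone : ∀ k i j, i ≤ j → chain k j ≤ chain k i
  zero : ∀ i, chain 0 i = 0
  last : ∀ i, chain (Fin.last r) i = α i
  mono : ∀ (k : Fin r) (i : ℕ), chain k.castSucc i ≤ chain k.succ i
  T : Fin r → ℕ → ℕ → ℕ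
  lr : ∀ k : Fin r, IsLR (chain k.succ) (chain k.castSucc) (T k)

/-- Content of the `k`-th tableau of a Littlewood–Richardson multitableau. -/
def LRMultiF.cont {r : ℕ} {α : ℕ → ℕ} (M : LRMultiF r α) (k : Fin r) : ℕ → ℕ :=
  skewContent (M.chain k.succ) (M.chain k.castSucc) (M.T k)

/-- Size of the `k`-th tableau of a Littlewood–Richardson multitableau. -/
def LRMultiF.size {r : ℕ} {α : ℕ → ℕ} (M : LRMultiF r α) (k : Fin r) : ℕ :=
  skewSize (M.chain k.succ) (M.chain k.castSucc)

/-- `LR(α,β;ν)`: pairs of Littlewood–Richardson multitableaux of shapes `α`, `β`,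
type `ν`, with equal contents. -/
def LRPairs (r : ℕ) (α β : ℕ → ℕ) (ν : Fin r → ℕ) :=
  {TS : LRMultiF r α × LRMultiF r β //
    (∀ k, TS.1.size k = ν k) ∧ (∀ k, TS.2.size k = ν k) ∧ ∀ k, TS.1.cont k = TS.2.cont k}

/-- `LR*(α,β;ν)`: pairs of Littlewood–Richardson multitableaux of shapes `α`, `β`,
type `ν`, with termwise conjugate contents. -/
def LRPairsStar (n r : ℕ) (α β : ℕ → ℕ) (ν : Fin r → ℕ) :=
  {TS : LRMultiF r α × LRMultiF r β //
    (∀ k, TS.1.size k = ν k) ∧ (∀ k, TS.2.size k = ν k) ∧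
      ∀ k m, TS.2.cont k m = conjFun n (TS.1.cont k) m}

/-- `lr(α,β;ν)`. -/
def lrNum (r : ℕ) (α β : ℕ → ℕ) (ν : Fin r → ℕ) : ℕ := Nat.card (LRPairs r α β ν)

/-- `lr*(α,β;ν)`. -/
def lrStarNum (n r : ℕ) (α β : ℕ → ℕ) (ν : Fin r → ℕ) : ℕ :=
  Nat.card (LRPairsStar n r α β ν)

/-- A semistandard Young tableau (of arbitrary partition shape). -/
structure SSYTP where
  shape : ℕ → ℕ
  T : ℕ → ℕ → ℕ
  antitone : ∀ i j, i ≤ j → shape j ≤ shape i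
  finite : ∃ N, ∀ i, N ≤ i → shape i = 0
  ssyt : IsSSYT shape T

/-- Content of a semistandard Young tableau. -/
def SSYTP.cont (P : SSYTP) : ℕ → ℕ := skewContent P.shape (fun _ => 0) P.T

/-- The multiset of entries of a matrix. -/
def entriesM {p q : ℕ} (A : Fin p → Fin q → ℕ) : Multiset ℕ :=
  (Finset.univ : Finset (Fin p × Fin q)).val.map (fun ij => A ij.1 ij.2)

/-- The π-sequence of `A` is the partition `ν` (the weakly decreasing rearrangement of
the entries of `A` is `ν`). -/
def HasPiSeq {p q : ℕ} (A : Fin p → Fin q → ℕ) {n : ℕ} (ν : n.Partition) : Prop :=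
  (entriesM A).filter (· ≠ 0) = ν.parts

end

/-- The number of elements of `Fin n` coloured `k` by `f`. -/
noncomputable def colorCount {n : ℕ} {κ : Type*} (f : Fin n → κ) (k : κ) : ℕ :=
  (univ.filter fun x => f x = k).card

/-- The colorings of `Fin n` with colour counts `T` which are fixed by `g`. -/
noncomputable def fixedColorings {n : ℕ} {κ : Type*} [Fintype κ] (T : κ → ℤ) (g : Perm (Fin n)) :
    Finset (Fin n → κ) :=
  univ.filter fun f => (∀ k, (colorCount f k : ℤ) = T k) ∧ ∀ x, f (g x) = f x

lemma mem_fixedColorings {n : ℕ} {κ : Type*} [Fintype κ] {T : κ → ℤ} {g : Perm (Fin n)}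
    {f : Fin n → κ} : f ∈ fixedColorings T g ↔
      (∀ k, (colorCount f k : ℤ) = T k) ∧ ∀ x, f (g x) = f x := by
  simp [fixedColorings]

lemma sum_colorCount {n : ℕ} {κ : Type*} [Fintype κ] (f : Fin n → κ) :
    ∑ k, colorCount f k = n := by
  unfold colorCount
  rw [← Finset.card_eq_sum_card_fiberwise (f := f) (t := univ) (s := univ) (by simp)]
  simp

lemma exists_coloring {n : ℕ} {κ : Type*} [Fintype κ] (T : κ → ℕ) (hT : ∑ k, T k = n) :
    ∃ f : Fin n → κ, ∀ k, colorCount f k = T k := by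
  have e : Fin n ≃ Σ k, Fin (T k) := Fintype.equivOfCardEq (by simp [hT])
  refine ⟨fun x => (e x).1, fun k => ?_⟩
  have e' : {x // (e x).1 = k} ≃ Fin (T k) :=
    (e.subtypeEquiv fun x => Iff.rfl).trans (Equiv.sigmaSubtype k)
  rw [colorCount, ← Fintype.card_subtype, Fintype.card_congr e', Fintype.card_fin]

lemma exists_perm_of_colorCount_eq {n : ℕ} {κ : Type*} (f f' : Fin n → κ)
    (h : ∀ k, colorCount f k = colorCount f' k) : ∃ g : Perm (Fin n), ∀ x, f' (g x) = f x := by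
  have e : ∀ k, {x // f x = k} ≃ {x // f' x = k} := fun k =>
    Fintype.equivOfCardEq (by simpa [Fintype.card_subtype, colorCount] using h k)
  refine ⟨(Equiv.sigmaFiberEquiv f).symm.trans
    ((Equiv.sigmaCongrRight e).trans (Equiv.sigmaFiberEquiv f')), fun x => ?_⟩
  exact (e (f x) ⟨x, rfl⟩).2

lemma sum_card_fixedColorings {n : ℕ} {κ : Type*} [Fintype κ] (T : κ → ℕ) (hT : ∑ k, T k = n) :
    ∑ g : Perm (Fin n), (fixedColorings (fun k => (T k : ℤ)) g).card = n.factorial := by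
  obtain ⟨f₀, h₀⟩ := exists_coloring T hT
  set S : Finset (Fin n → κ) := univ.filter fun f => ∀ k, colorCount f k = T k with hS
  have h1 : ∀ g : Perm (Fin n), (fixedColorings (fun k => (T k : ℤ)) g).card =
      ∑ f ∈ S, if ∀ x, f (g x) = f x then 1 else 0 := by
    intro g
    rw [← Finset.sum_filter, Finset.card_eq_sum_ones, hS, Finset.filter_filter]
    simp [fixedColorings]
  have h2 : ∀ f ∈ S, (univ.filter fun g : Perm (Fin n) => ∀ x, f (g x) = f x).card =
      (univ.filter fun g : Perm (Fin n) => f₀ ∘ g = f).card := by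
    intro f hf
    obtain ⟨h, hh⟩ := exists_perm_of_colorCount_eq f f₀ (fun k => by
      rw [h₀ k]; exact (mem_filter.1 hf).2 k)
    refine Finset.card_equiv (Equiv.mulLeft h) fun g => ?_
    simp [funext_iff, hh]
  have h3 : ∀ g ∈ (univ : Finset (Perm (Fin n))), f₀ ∘ g ∈ S := by
    intro g _
    simp only [hS, mem_filter, mem_univ, true_and]
    intro k
    rw [← h₀ k]
    exact Finset.card_equiv g fun x => by simp
  simp_rw [h1]
  rw [Finset.sum_comm]
  simp_rw [Finset.sum_boole]
  rw [Finset.sum_congr rfl fun f hf => congrArg Nat.cast (h2 f hf)]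
  have := Finset.card_eq_sum_card_fiberwise h3
  rw [Finset.card_univ, Fintype.card_perm, Fintype.card_fin] at this
  simpa using this.symm

lemma colorCount_pair {n : ℕ} {κ κ' : Type*} [Fintype κ] [Fintype κ'] (f : Fin n → κ × κ') :
    (∀ k, ∑ k', colorCount f (k, k') = colorCount (fun x => (f x).1) k) ∧
    (∀ k', ∑ k, colorCount f (k, k') = colorCount (fun x => (f x).2) k') := by
  constructor <;> intro k
  · unfold colorCount
    rw [Finset.card_eq_sum_card_fiberwise (f := fun x => (f x).2) (t := univ) (by simp)]
    refine Finset.sum_congr rfl fun k' _ => congrArg _ ?_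
    ext x
    simp [Prod.ext_iff]
  · unfold colorCount
    rw [Finset.card_eq_sum_card_fiberwise (f := fun x => (f x).1) (t := univ) (by simp)]
    refine Finset.sum_congr rfl fun k' _ => congrArg _ ?_
    ext x
    simp [Prod.ext_iff, and_comm]

/-- Nonnegative integer matrices of total sum `n` with given (integer) margins. -/
noncomputable def margins (n : ℕ) {κ κ' : Type*} [Fintype κ] [Fintype κ'] (a : κ → ℤ) (b : κ' → ℤ) :
    Finset (κ × κ' → ℕ) :=
  (piAntidiag univ n).filter fun T =>
    (∀ k, ((∑ k', T (k, k') : ℕ) : ℤ) = a k) ∧ ∀ k', ((∑ k, T (k, k') : ℕ) : ℤ) = b k'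

lemma card_fixedColorings_mul {n : ℕ} {κ κ' : Type*} [Fintype κ] [Fintype κ']
    (a : κ → ℤ) (b : κ' → ℤ) (g : Perm (Fin n)) :
    (fixedColorings a g).card * (fixedColorings b g).card =
      ∑ T ∈ margins n a b, (fixedColorings (fun k => (T k : ℤ)) g).card := by
  rw [← Finset.card_product]
  have h : ∀ p ∈ fixedColorings a g ×ˢ fixedColorings b g,
      colorCount (fun x => (p.1 x, p.2 x)) ∈ margins n a b := by
    intro p hp
    simp only [mem_product, fixedColorings, mem_filter, mem_univ, true_and] at hp
    have := colorCount_pair (fun x => (p.1 x, p.2 x))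
    simp only [margins, mem_filter, mem_piAntidiag, sum_colorCount, mem_univ, implies_true,
      this.1, this.2, true_and]
    exact ⟨hp.1.1, hp.2.1⟩
  rw [Finset.card_eq_sum_card_fiberwise h]
  refine Finset.sum_congr rfl fun T hT => ?_
  refine Finset.card_equiv (Equiv.arrowProdEquivProdArrow (Fin n) (fun _ => κ) (fun _ => κ')).symm fun p => ?_
  simp only [margins, mem_filter, mem_piAntidiag] at hT
  have := colorCount_pair (fun x => (p.1 x, p.2 x))
  simp only [mem_filter, mem_product, fixedColorings, mem_univ, true_and,
    Equiv.arrowProdEquivProdArrow, Equiv.coe_fn_symm_mk, Prod.ext_iff]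
  constructor
  · rintro ⟨⟨⟨-, h1⟩, -, h2⟩, rfl⟩
    exact ⟨fun k => rfl, fun x => ⟨h1 x, h2 x⟩⟩
  · rintro ⟨h1, h2⟩
    have h3 : colorCount (fun x => (p.1 x, p.2 x)) = T := funext fun k => by exact_mod_cast h1 k
    refine ⟨⟨⟨fun k => ?_, fun x => (h2 x).1⟩, fun k => ?_, fun x => (h2 x).2⟩, h3⟩
    · rw [← hT.2.1 k, ← h3, this.1 k]
    · rw [← hT.2.2 k, ← h3, this.2 k]

lemma sum_card_fixedColorings_triple {n : ℕ} {κ κ' κ'' : Type*} [Fintype κ] [Fintype κ']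
    [Fintype κ''] (a : κ → ℤ) (b : κ' → ℤ) (d : κ'' → ℤ) :
    ∑ g : Perm (Fin n), (fixedColorings a g).card * (fixedColorings b g).card *
      (fixedColorings d g).card =
    n.factorial * ∑ A ∈ margins n a b, (margins n (fun x => (A x : ℤ)) d).card := by
  simp_rw [card_fixedColorings_mul, Finset.sum_mul, card_fixedColorings_mul]
  rw [Finset.sum_comm, Finset.mul_sum]
  refine Finset.sum_congr rfl fun A _ => ?_
  rw [Finset.sum_comm, Finset.card_eq_sum_ones, Finset.mul_sum]
  refine Finset.sum_congr rfl fun T hT => ?_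
  rw [mul_one, sum_card_fixedColorings]
  simp only [margins, mem_filter, mem_piAntidiag] at hT
  exact hT.1.1

lemma permCharZ_eq {n : ℕ} (d : Fin n → ℤ) (g : Perm (Fin n)) :
    permCharZ n (fun i => if h : i < n then d ⟨i, h⟩ else 0) g = (fixedColorings d g).card := by
  unfold permCharZ
  split_ifs with h
  · rw [permChar, Nat.cast_inj]
    rw [← Nat.card_eq_finsetCard]
    have key : ∀ f : Fin n → ℕ, (∀ k, Nat.card {x : Fin n // f x = k} =
        (if h : k < n then d ⟨k, h⟩ else 0 : ℤ).toNat) → ∀ x, f x < n := by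
      intro f hf x
      by_contra hx
      have := hf (f x)
      rw [dif_neg hx, Int.toNat_zero, Nat.card_eq_zero] at this
      rcases this with h | h
      · exact h.elim ⟨x, rfl⟩
      · exact h.not_finite inferInstance
    have cc : ∀ (f : Fin n → Fin n) (k : Fin n),
        Nat.card {x : Fin n // (f x : ℕ) = k} = colorCount f k := by
      intro f k
      rw [Nat.card_eq_fintype_card, Fintype.card_subtype, colorCount]
      simp [Fin.ext_iff]
    refine Nat.card_congr
      { toFun := fun f => ⟨fun x => ⟨f.1 x, key f.1 f.2.1 x⟩, ?_⟩
        invFun := fun f => ⟨fun x => (f.1 x : ℕ), ?_⟩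
        left_inv := fun f => rfl
        right_inv := fun f => rfl }
    · simp only [fixedColorings, mem_filter, mem_univ, true_and, Fin.mk.injEq]
      refine ⟨fun k => ?_, f.2.2⟩
      rw [← cc]
      have h1 := h k
      have h2 := f.2.1 k
      beta_reduce at h1 h2
      rw [dif_pos k.2] at h1 h2
      simp only [h2]
      exact Int.toNat_of_nonneg h1
    · have hf := f.2
      simp only [fixedColorings, mem_filter, mem_univ, true_and] at hf
      refine ⟨fun k => ?_, fun x => congrArg Fin.val (hf.2 x)⟩
      beta_reduce
      by_cases hk : k < n
      · rw [dif_pos hk, ← hf.1 ⟨k, hk⟩, ← cc]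
        simp
      · rw [dif_neg hk, Int.toNat_zero, Nat.card_eq_zero]
        left
        exact ⟨fun x => hk (x.2 ▸ (f.1 x.1).2)⟩
  · push Not at h
    obtain ⟨k, hk⟩ := h
    split_ifs at hk with h'
    · rw [eq_comm, Nat.cast_eq_zero, Finset.card_eq_zero]
      refine Finset.eq_empty_of_forall_notMem fun f hf => ?_
      rw [mem_fixedColorings] at hf
      have := hf.1 ⟨k, h'⟩
      omega
    · omega

/-- The `i`-th index in the term of the Jacobi–Trudi determinant given by `σ`. -/
def jtIndex {n : ℕ} (a : ℕ → ℕ) (σ : Perm (Fin n)) (i : Fin n) : ℤ :=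
  (a i : ℤ) - i + (σ i : ℕ)

lemma irrChar_eq {n : ℕ} (a : ℕ → ℕ) (g : Perm (Fin n)) :
    irrChar n a g = ∑ σ : Perm (Fin n), ((Perm.sign σ : ℤ) : ℚ) *
      (fixedColorings (jtIndex a σ) g).card := by
  unfold irrChar
  refine Finset.sum_congr rfl fun σ _ => ?_
  rw [← permCharZ_eq]
  rfl

lemma kron_eq {n : ℕ} (a b c : ℕ → ℕ) :
    kron n a b c = ∑ σ : Perm (Fin n), ∑ τ : Perm (Fin n),
      ((Perm.sign σ : ℤ) : ℚ) * ((Perm.sign τ : ℤ) : ℚ) *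
      ∑ A ∈ margins n (jtIndex a σ) (jtIndex b τ), ∑ ρ : Perm (Fin n),
        ((Perm.sign ρ : ℤ) : ℚ) * (margins n (fun x => (A x : ℤ)) (jtIndex c ρ)).card := by
  have hn : (n.factorial : ℚ) ≠ 0 := by exact_mod_cast n.factorial_ne_zero
  rw [kron, innerChar, div_eq_iff hn]
  simp_rw [irrChar_eq, mul_assoc, Finset.sum_mul, Finset.mul_sum]
  rw [Finset.sum_comm]
  refine Finset.sum_congr rfl fun σ _ => ?_
  rw [Finset.sum_comm]
  refine Finset.sum_congr rfl fun τ _ => ?_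
  rw [Finset.sum_comm, Finset.sum_mul]
  simp_rw [Finset.sum_mul]
  conv_rhs => rw [Finset.sum_comm]
  refine Finset.sum_congr rfl fun ρ _ => ?_
  have h := congrArg (Nat.cast : ℕ → ℚ)
    (sum_card_fixedColorings_triple (n := n) (jtIndex a σ) (jtIndex b τ) (jtIndex c ρ))
  push_cast at h
  trans ((Perm.sign σ : ℤ) : ℚ) * ((Perm.sign τ : ℤ) : ℚ) * ((Perm.sign ρ : ℤ) : ℚ) *
      ∑ g : Perm (Fin n), (((fixedColorings (jtIndex a σ) g).card : ℚ) * ((fixedColorings (jtIndex b τ) g).card : ℚ) *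
      ((fixedColorings (jtIndex c ρ) g).card : ℚ))
  · rw [Finset.mul_sum]
    exact Finset.sum_congr rfl fun g _ => by ring
  · rw [h, Finset.mul_sum, Finset.mul_sum]
    exact Finset.sum_congr rfl fun A _ => by ring

/-- The complete homogeneous symmetric polynomial of degree `c` in `n` variables. -/
noncomputable def completeHom (n c : ℕ) : MvPolynomial (Fin n) ℚ :=
  ∑ r ∈ finsuppAntidiag univ c, MvPolynomial.monomial r 1

/-- The exponent `j ↦ n - 1 - ρ j`. -/
noncomputable def staircase {n : ℕ} (ρ : Perm (Fin n)) : Fin n →₀ ℕ :=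
  Finsupp.equivFunOnFinite.symm fun j => n - 1 - (ρ j : ℕ)

/-- The Vandermonde alternant. -/
noncomputable def alternant (n : ℕ) : MvPolynomial (Fin n) ℚ :=
  ∑ ρ : Perm (Fin n), MvPolynomial.monomial (staircase ρ) ((Perm.sign ρ : ℤ) : ℚ)

/-- A polynomial which changes sign when two variables are exchanged. -/
def IsAlternating {n : ℕ} (Q : MvPolynomial (Fin n) ℚ) : Prop :=
  ∀ i j : Fin n, i ≠ j → MvPolynomial.rename (swap i j) Q = -Q

lemma coeff_completeHom {n c : ℕ} (s : Fin n →₀ ℕ) :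
    MvPolynomial.coeff s (completeHom n c) = if ∑ i, s i = c then 1 else 0 := by
  simp [completeHom, MvPolynomial.coeff_sum, MvPolynomial.coeff_monomial]

lemma completeHom_zero (n : ℕ) : completeHom n 0 = 1 := by
  simp [completeHom]

lemma coeff_completeHom_mul {n c : ℕ} (Q : MvPolynomial (Fin n) ℚ) (b : Fin n →₀ ℕ) :
    MvPolynomial.coeff b (completeHom n c * Q) =
      ∑ s ∈ (Finset.Iic b).filter (fun s => ∑ i, s i + c = ∑ i, b i), MvPolynomial.coeff s Q := by
  rw [MvPolynomial.coeff_mul]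
  simp_rw [coeff_completeHom, ite_mul, one_mul, zero_mul]
  rw [← Finset.sum_filter]
  refine Finset.sum_bij (fun p _ => p.2) ?_ ?_ ?_ ?_
  · rintro ⟨r, s⟩ h
    simp only [mem_filter, HasAntidiagonal.mem_antidiagonal] at h
    obtain ⟨rfl, rfl⟩ := h
    simp [Finset.sum_add_distrib, add_comm]
  · rintro ⟨r, s⟩ h ⟨r', s'⟩ h' (rfl : s = s')
    simp only [mem_filter, HasAntidiagonal.mem_antidiagonal] at h h'
    have := add_right_cancel (h.1.trans h'.1.symm)
    rw [this]
  · intro s h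
    simp only [mem_filter, mem_Iic] at h
    have e : b - s + s = b := tsub_add_cancel_of_le h.1
    refine ⟨(b - s, s), ?_, rfl⟩
    simp only [mem_filter, HasAntidiagonal.mem_antidiagonal, e, true_and]
    have := congrArg (fun f : Fin n →₀ ℕ => ∑ i, f i) e
    simp only [Finsupp.add_apply, Finset.sum_add_distrib] at this
    omega
  · intros; rfl

lemma coeff_equivMapDomain {n : ℕ} {Q : MvPolynomial (Fin n) ℚ} (hQ : IsAlternating Q)
    {i j : Fin n} (hij : i ≠ j) (s : Fin n →₀ ℕ) :
    MvPolynomial.coeff (s.equivMapDomain (swap i j)) Q = - MvPolynomial.coeff s Q := by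
  have h := MvPolynomial.coeff_rename_mapDomain (swap i j) (swap i j).injective Q s
  rw [hQ i j hij, MvPolynomial.coeff_neg] at h
  rw [Finsupp.equivMapDomain_eq_mapDomain, ← h, neg_neg]

lemma IsAlternating.completeHom_mul {n c : ℕ} {Q : MvPolynomial (Fin n) ℚ}
    (hQ : IsAlternating Q) : IsAlternating (completeHom n c * Q) := by
  intro i j hij
  have : MvPolynomial.rename (swap i j) (completeHom n c) = completeHom n c := by
    simp only [completeHom, map_sum, MvPolynomial.rename_monomial]
    refine Finset.sum_equiv (Finsupp.domCongr (M := ℕ) (swap i j)).toEquiv ?_ ?_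
    · intro r
      have := Equiv.sum_comp (swap i j) r
      simp only [mem_finsuppAntidiag, subset_univ, and_true]
      change _ ↔ ∑ k, r ((swap i j).symm k) = c
      rw [symm_swap, this]
    · intro r _
      simp [Finsupp.equivMapDomain_eq_mapDomain]
  rw [map_mul, this, hQ i j hij, mul_neg]

lemma isAlternating_alternant (n : ℕ) : IsAlternating (alternant n) := by
  intro i j hij
  simp only [alternant, map_sum, MvPolynomial.rename_monomial]
  rw [← Finset.sum_neg_distrib]
  refine Finset.sum_equiv (Equiv.mulRight (swap i j)) (by simp) fun ρ _ => ?_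
  rw [← Finsupp.equivMapDomain_eq_mapDomain]
  have : Finsupp.equivMapDomain (swap i j) (staircase ρ) = staircase (ρ * swap i j) := by
    ext k
    simp [staircase]
  rw [this]
  simp [Perm.sign_swap hij]

/-- The exponents `s` obtained from the strictly decreasing exponent `b` by removing a horizontal
strip of size `c`. -/
noncomputable def strips {n : ℕ} (c : ℕ) (b : Fin n →₀ ℕ) : Finset (Fin n →₀ ℕ) :=
  ((Finset.Iic b).filter (fun s => ∑ i, s i + c = ∑ i, b i)).filter fun s =>
    ∀ i j : Fin n, (i : ℕ) + 1 = j → b j < s i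

lemma coeff_completeHom_mul_of_alternating {n c : ℕ} {Q : MvPolynomial (Fin n) ℚ}
    (hQ : IsAlternating Q) (b : Fin n →₀ ℕ) (hb : Antitone b) :
    MvPolynomial.coeff b (completeHom n c * Q) = ∑ s ∈ strips c b, MvPolynomial.coeff s Q := by
  rw [coeff_completeHom_mul, strips,
    ← Finset.sum_filter_add_sum_filter_not _ (fun s => ∀ i j : Fin n, (i : ℕ) + 1 = j → b j < s i)]
  rw [add_eq_left]
  set B := ((Finset.Iic b).filter (fun s => ∑ i, s i + c = ∑ i, b i)).filter
    (fun s => ¬ ∀ i j : Fin n, (i : ℕ) + 1 = j → b j < s i) with hB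
  have ex : ∀ s ∈ B, ∃ i : ℕ, ∃ hi : i + 1 < n, s ⟨i, by omega⟩ ≤ b ⟨i + 1, hi⟩ := by
    intro s hs
    have := (mem_filter.1 hs).2
    push Not at this
    obtain ⟨i, j, hij, h⟩ := this
    obtain ⟨j, hj⟩ := j
    obtain rfl : (i : ℕ) + 1 = j := hij
    exact ⟨i, hj, h⟩
  let I : ∀ s ∈ B, Fin n := fun s hs =>
    ⟨Nat.find (ex s hs), by obtain ⟨h, -⟩ := Nat.find_spec (ex s hs); omega⟩
  let J : ∀ s ∈ B, Fin n := fun s hs =>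
    ⟨Nat.find (ex s hs) + 1, (Nat.find_spec (ex s hs)).1⟩
  have hIJ : ∀ s hs, I s hs ≠ J s hs := fun s hs h => by
    simp [I, J, Fin.ext_iff] at h
  have hle : ∀ s hs, s (I s hs) ≤ b (J s hs) := fun s hs => (Nat.find_spec (ex s hs)).2
  have mem : ∀ (s : Fin n →₀ ℕ) (hs : s ∈ B), s.equivMapDomain (swap (I s hs) (J s hs)) ∈ B := by
    intro s hs
    have h1 := hle s hs
    have hs' := hs
    simp only [hB, mem_filter, mem_Iic] at hs' ⊢
    refine ⟨⟨fun k => ?_, ?_⟩, ?_⟩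
    · rw [Finsupp.equivMapDomain_apply, symm_swap]
      by_cases hk : k = I s hs
      · rw [hk, swap_apply_left]
        exact (hs'.1.1 _).trans (hb (by simp [I, J, Fin.le_def]))
      by_cases hk' : k = J s hs
      · rwa [hk', swap_apply_right]
      rw [swap_apply_of_ne_of_ne hk hk']
      exact hs'.1.1 k
    · rw [← hs'.1.2]
      simp only [Finsupp.equivMapDomain_apply, symm_swap]
      rw [Equiv.sum_comp (swap (I s hs) (J s hs)) s]
    · push Not
      refine ⟨I s hs, J s hs, rfl, ?_⟩
      rw [Finsupp.equivMapDomain_apply, symm_swap, swap_apply_left]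
      exact hs'.1.1 _
  have same : ∀ s hs, Nat.find (ex _ (mem s hs)) = Nat.find (ex s hs) := by
    intro s hs
    rw [Nat.find_eq_iff]
    refine ⟨⟨(J s hs).2, ?_⟩, fun m hm => ?_⟩
    · change s.equivMapDomain _ (I s hs) ≤ b (J s hs)
      rw [Finsupp.equivMapDomain_apply, symm_swap, swap_apply_left]
      exact (mem_Iic.1 (mem_filter.1 (mem_filter.1 hs).1).1) _
    · have h2 := Nat.find_min (ex s hs) hm
      rintro ⟨h3, h4⟩
      refine h2 ⟨h3, ?_⟩
      rwa [Finsupp.equivMapDomain_apply, symm_swap, swap_apply_of_ne_of_ne] at h4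
      · simp only [I, ne_eq, Fin.mk.injEq]; omega
      · simp only [J, ne_eq, Fin.mk.injEq]; omega
  refine Finset.sum_involution (fun s hs => s.equivMapDomain (swap (I s hs) (J s hs))) ?_ ?_ mem ?_
  · intro s hs
    rw [coeff_equivMapDomain hQ (hIJ s hs)]
    ring
  · intro s hs h h'
    have := coeff_equivMapDomain hQ (hIJ s hs) s
    rw [h'] at this
    exact h (by linarith)
  · intro s hs
    have e1 : I _ (mem s hs) = I s hs := Fin.ext (same s hs)
    have e2 : J _ (mem s hs) = J s hs := Fin.ext (congrArg (· + 1) (same s hs))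
    rw [e1, e2]
    ext k
    simp

lemma mem_strips {n c : ℕ} {b s : Fin n →₀ ℕ} : s ∈ strips c b ↔
    (∀ i, s i ≤ b i) ∧ ∑ i, s i + c = ∑ i, b i ∧ ∀ i j : Fin n, (i : ℕ) + 1 = j → b j < s i := by
  simp only [strips, mem_filter, mem_Iic, and_assoc]
  rfl

lemma strictAnti_of_mem_strips {n c : ℕ} {b s : Fin n →₀ ℕ} (hb : StrictAnti b)
    (hs : s ∈ strips c b) : StrictAnti s := by
  rw [mem_strips] at hs
  intro i j hij
  have h : (⟨i + 1, by omega⟩ : Fin n) ≤ j := Fin.le_def.2 (by simpa using hij)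
  exact ((hs.1 j).trans (hb.antitone h)).trans_lt (hs.2.2 i _ rfl)

lemma sum_truncated_of_mem_strips {n c : ℕ} {b s : Fin n →₀ ℕ} (hs : s ∈ strips c b) (t : ℕ) :
    ∑ j : Fin n, (s j - (t + (n - 1 - j))) + (c - t) ≤ ∑ j : Fin n, (b j - (t + (n - 1 - j))) := by
  rw [mem_strips] at hs
  obtain ⟨hle, hsum, hstrict⟩ := hs
  rcases n with _ | m
  · simp only [univ_eq_empty, sum_empty] at hsum ⊢
    omega
  have hmin : ∑ j : Fin (m + 1), min (b j) (t + (m + 1 - 1 - j)) ≤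
      ∑ j : Fin (m + 1), min (s j) (t + (m + 1 - 1 - j)) + t := by
    rw [Fin.sum_univ_succ, Fin.sum_univ_castSucc (fun j : Fin (m + 1) => min (s j) _)]
    have h : ∑ j : Fin m, (min (b j.succ) (t + (m + 1 - 1 - (j.succ : ℕ))) + 1) ≤
        ∑ j : Fin m, min (s j.castSucc) (t + (m + 1 - 1 - (j.castSucc : ℕ))) := by
      refine Finset.sum_le_sum fun j _ => ?_
      have := hstrict j.castSucc j.succ rfl
      have hj := j.2
      simp only [Fin.val_succ, Fin.val_castSucc]
      omega
    rw [Finset.sum_add_distrib] at h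
    simp only [sum_const, card_univ, Fintype.card_fin, smul_eq_mul, mul_one] at h
    have : min (b 0) (t + (m + 1 - 1 - ((0 : Fin (m + 1)) : ℕ))) ≤ t + m := by simp
    omega
  have hsplit : ∀ f : Fin (m + 1) →₀ ℕ, ∑ j, f j = ∑ j : Fin (m + 1), (f j - (t + (m + 1 - 1 - j))) +
      ∑ j : Fin (m + 1), min (f j) (t + (m + 1 - 1 - j)) := fun f => by
    rw [← Finset.sum_add_distrib]
    exact Finset.sum_congr rfl fun j _ => by omega
  have hmono : ∑ j : Fin (m + 1), (s j - (t + (m + 1 - 1 - j))) ≤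
      ∑ j : Fin (m + 1), (b j - (t + (m + 1 - 1 - j))) :=
    Finset.sum_le_sum fun j _ => by have := hle j; omega
  have h1 := hsplit s
  have h2 := hsplit b
  omega

lemma isAlternating_prod_completeHom_mul_alternant (n : ℕ) (s : Multiset ℕ) :
    IsAlternating ((s.map (completeHom n)).prod * alternant n) := by
  induction s using Multiset.induction_on with
  | empty => simpa using isAlternating_alternant n
  | cons c s ih =>
    rw [Multiset.map_cons, Multiset.prod_cons, mul_assoc]
    exact ih.completeHom_mul

lemma sum_truncated_le_of_coeff_ne_zero {n : ℕ} (c : Multiset ℕ) (t : ℕ) (b : Fin n →₀ ℕ)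
    (hb : StrictAnti b)
    (h : MvPolynomial.coeff b ((c.map (completeHom n)).prod * alternant n) ≠ 0) :
    (c.map (· - t)).sum ≤ ∑ j : Fin n, (b j - (t + (n - 1 - j))) := by
  induction c using Multiset.induction_on generalizing b with
  | empty => simp
  | cons c s ih =>
    rw [Multiset.map_cons, Multiset.prod_cons, mul_assoc, coeff_completeHom_mul_of_alternating
      (isAlternating_prod_completeHom_mul_alternant n s) b hb.antitone] at h
    obtain ⟨r, hr, hne⟩ := Finset.exists_ne_zero_of_sum_ne_zero h
    have h1 := ih r (strictAnti_of_mem_strips hb hr) hne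
    have h2 := sum_truncated_of_mem_strips hr t
    rw [Multiset.map_cons, Multiset.sum_cons]
    omega

/-- The exponent `j ↦ g j + (n - 1 - j)`. -/
noncomputable def addStaircase (n : ℕ) (g : ℕ → ℕ) : Fin n →₀ ℕ :=
  Finsupp.equivFunOnFinite.symm fun j => g j + (n - 1 - j)

lemma strictAnti_addStaircase {n : ℕ} {g : ℕ → ℕ} (hg : Antitone g) :
    StrictAnti (addStaircase n g) := by
  intro i j hij
  have := hg (Fin.le_def.1 hij.le)
  have := j.2
  rw [Fin.lt_def] at hij
  simp only [addStaircase, Finsupp.equivFunOnFinite_symm_apply_apply]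
  omega

lemma strips_addStaircase {n : ℕ} {g : ℕ → ℕ} (hg : Antitone g) (hn : g n = 0) :
    strips (g 0) (addStaircase n g) = {addStaircase n fun i => g (i + 1)} := by
  ext s
  rw [mem_strips, mem_singleton]
  rcases n with _ | m
  · simp [hn, Subsingleton.elim s (addStaircase 0 fun i => g (i + 1))]
  have key : ∀ j : Fin m, (addStaircase (m + 1) g) j.succ + 1 =
      (addStaircase (m + 1) fun i => g (i + 1)) j.castSucc := fun j => by
    have := j.2
    simp only [addStaircase, Finsupp.equivFunOnFinite_symm_apply_apply, Fin.val_succ,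
      Fin.val_castSucc]
    omega
  have h0 : (addStaircase (m + 1) g) 0 = g 0 + m := by
    simp [addStaircase]
  have hl : (addStaircase (m + 1) fun i => g (i + 1)) (Fin.last m) = 0 := by
    simp [addStaircase, hn]
  have hsum : ∑ i, (addStaircase (m + 1) fun i => g (i + 1)) i + g 0 =
      ∑ i, (addStaircase (m + 1) g) i := by
    rw [Fin.sum_univ_castSucc, Fin.sum_univ_succ (addStaircase (m + 1) g), hl, h0]
    simp_rw [← key]
    simp only [sum_add_distrib, sum_const, card_univ, Fintype.card_fin, smul_eq_mul, mul_one]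
    omega
  constructor
  · rintro ⟨hle, hs, hstrict⟩
    have hge : ∀ i ∈ univ, (addStaircase (m + 1) fun i => g (i + 1)) i ≤ s i := by
      intro i _
      induction i using Fin.lastCases with
      | last => rw [hl]; exact Nat.zero_le _
      | cast j => rw [← key]; exact hstrict _ _ rfl
    have := (Finset.sum_eq_sum_iff_of_le hge).1 (by omega)
    ext i
    exact (this i (mem_univ i)).symm
  · rintro rfl
    refine ⟨fun i => ?_, hsum, fun i j hij => ?_⟩
    · simp only [addStaircase, Finsupp.equivFunOnFinite_symm_apply_apply]
      have := hg (Nat.le_succ i)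
      simp only [Nat.succ_eq_add_one] at this
      omega
    · have := j.2
      simp only [addStaircase, Finsupp.equivFunOnFinite_symm_apply_apply, ← hij]
      omega

lemma coeff_staircase_alternant (n : ℕ) :
    MvPolynomial.coeff (addStaircase n fun _ => 0) (alternant n) = 1 := by
  rw [alternant, MvPolynomial.coeff_sum, Finset.sum_eq_single 1]
  · rw [MvPolynomial.coeff_monomial, if_pos]
    · simp
    · ext j
      simp [staircase, addStaircase]
  · intro ρ _ hρ
    rw [MvPolynomial.coeff_monomial, if_neg]
    intro h
    refine hρ (Equiv.ext fun j => Fin.ext ?_)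
    have := DFunLike.congr_fun h j
    simp only [staircase, addStaircase, Finsupp.equivFunOnFinite_symm_apply_apply] at this
    have := j.2
    have := (ρ j).2
    simp only [Perm.one_apply]
    omega
  · simp

lemma coeff_addStaircase_self {n m : ℕ} {g : ℕ → ℕ} (hg : Antitone g) (hn : g n = 0)
    (hm : ∀ i, m ≤ i → g i = 0) :
    MvPolynomial.coeff (addStaircase n g)
      (((Multiset.range m).map fun i => completeHom n (g i)).prod * alternant n) = 1 := by
  induction m generalizing g with
  | zero =>
    obtain rfl : g = fun _ => 0 := funext fun i => hm i (Nat.zero_le i)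
    simpa using coeff_staircase_alternant n
  | succ m ih =>
    have e : ((Multiset.range (m + 1)).map fun i => completeHom n (g i)).prod =
        completeHom n (g 0) * ((Multiset.range m).map fun i => completeHom n (g (i + 1))).prod :=
      Finset.prod_range_succ' (fun i => completeHom n (g i)) m |>.trans (mul_comm _ _)
    have alt := isAlternating_prod_completeHom_mul_alternant n
      ((Multiset.range m).map fun i => g (i + 1))
    rw [Multiset.map_map] at alt
    simp only [Function.comp_def] at alt
    rw [e, mul_assoc, coeff_completeHom_mul_of_alternating alt _ (strictAnti_addStaircase hg).antitone,
      strips_addStaircase hg hn, sum_singleton]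
    exact ih (fun i j h => hg (by omega)) (Nat.le_zero.1 (hn ▸ hg (Nat.le_succ n)))
      fun i hi => hm _ (by omega)

lemma mem_margins {n : ℕ} {κ κ' : Type*} [Fintype κ] [Fintype κ'] {a : κ → ℤ} {b : κ' → ℤ}
    {T : κ × κ' → ℕ} : T ∈ margins n a b ↔ ∑ x, T x = n ∧
      (∀ k, ((∑ k', T (k, k') : ℕ) : ℤ) = a k) ∧ ∀ k', ((∑ k, T (k, k') : ℕ) : ℤ) = b k' := by
  simp [margins]

lemma card_margins_eq_coeff {n : ℕ} {κ : Type*} [Fintype κ] (A : κ → ℕ) (hA : ∑ x, A x = n)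
    (d : Fin n →₀ ℕ) :
    ((margins n (fun x => (A x : ℤ)) fun j => (d j : ℤ)).card : ℚ) =
      MvPolynomial.coeff d (∏ x, completeHom n (A x)) := by
  simp only [completeHom]
  rw [Finset.prod_univ_sum, MvPolynomial.coeff_sum]
  simp_rw [← MvPolynomial.monomial_sum_one, MvPolynomial.coeff_monomial, Finset.sum_boole,
    Nat.cast_inj]
  symm
  refine Finset.card_equiv ((Equiv.arrowCongr (Equiv.refl κ) Finsupp.equivFunOnFinite).trans
    (Equiv.curry κ (Fin n) ℕ).symm) fun R => ?_
  have e : ∀ x j, ((Equiv.arrowCongr (Equiv.refl κ) Finsupp.equivFunOnFinite).trans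
    (Equiv.curry κ (Fin n) ℕ).symm) R (x, j) = R x j := fun _ _ => rfl
  simp only [mem_filter, Fintype.mem_piFinset, mem_finsuppAntidiag, subset_univ, and_true,
    mem_margins, e, Nat.cast_inj, Fintype.sum_prod_type]
  constructor
  · rintro ⟨h1, rfl⟩
    exact ⟨by simp [h1, hA], h1, fun j => by simp⟩
  · rintro ⟨-, h1, h2⟩
    exact ⟨h1, by ext j; simp [h2]⟩

lemma sum_sign_card_margins {n : ℕ} {κ : Type*} [Fintype κ] (A : κ → ℕ) (hA : ∑ x, A x = n)
    (c : ℕ → ℕ) :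
    ∑ ρ : Perm (Fin n), ((Perm.sign ρ : ℤ) : ℚ) *
      (margins n (fun x => (A x : ℤ)) (jtIndex c ρ)).card =
    MvPolynomial.coeff (addStaircase n c) ((∏ x, completeHom n (A x)) * alternant n) := by
  rw [alternant, Finset.mul_sum, MvPolynomial.coeff_sum]
  refine Finset.sum_congr rfl fun ρ _ => ?_
  rw [MvPolynomial.coeff_mul_monomial', mul_comm]
  have key : ∀ j, jtIndex c ρ j = (addStaircase n c j : ℤ) - (staircase ρ j : ℤ) := by
    intro j
    have := j.2
    have := (ρ j).2
    simp only [jtIndex, addStaircase, staircase, Finsupp.equivFunOnFinite_symm_apply_apply]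
    omega
  split_ifs with h
  · rw [← card_margins_eq_coeff A hA]
    congr
    ext j
    have := h j
    rw [key, Finsupp.tsub_apply]
    omega
  · rw [Nat.cast_eq_zero.2, zero_mul]
    rw [Finset.card_eq_zero]
    refine Finset.eq_empty_of_forall_notMem fun T hT => h fun j => ?_
    have := (mem_margins.1 hT).2.2 j
    rw [key] at this
    omega

lemma length_sort_parts_le {n : ℕ} (P : n.Partition) :
    ((P.parts.sort (· ≤ ·)).reverse).length ≤ n := by
  rw [List.length_reverse, Multiset.length_sort]
  calc P.parts.card ≤ P.parts.sum := by
        simpa using Multiset.card_nsmul_le_sum (s := P.parts) (a := 1) fun x hx => P.parts_pos hx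
    _ = n := P.parts_sum

lemma pf_eq_zero {n : ℕ} (P : n.Partition) {i : ℕ} (hi : n ≤ i) : pf P i = 0 :=
  List.getD_eq_default _ _ ((length_sort_parts_le P).trans hi)

/-- The parts of `P` are the nonzero terms among the first `n` values of `pf P`. -/
lemma map_pf_range {n : ℕ} (P : n.Partition) :
    ((Multiset.range n).map (pf P)).filter (· ≠ 0) = P.parts := by
  have hlen := length_sort_parts_le P
  set l := (P.parts.sort (· ≤ ·)).reverse with hl
  have hcoe : (l : Multiset ℕ) = P.parts := by
    rw [hl, Multiset.coe_reverse, Multiset.sort_eq]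
  have hpos : ∀ x ∈ l, x ≠ 0 := fun x hx =>
    (P.parts_pos (hcoe ▸ (Multiset.mem_coe.2 hx))).ne'
  obtain ⟨d, hd⟩ : ∃ d, n = l.length + d := ⟨n - l.length, by omega⟩
  have e : (List.range n).map (pf P) = l ++ List.replicate d 0 := by
    refine List.ext_getElem (by simp [← hd]) fun i h1 h2 => ?_
    simp only [List.getElem_map, List.getElem_range, pf, ← hl, List.getD_eq_getElem?_getD]
    by_cases h : i < l.length
    · simp [h]
    · rw [List.getElem_append_right (by omega)]
      simp [h]
  rw [← Multiset.coe_range, Multiset.map_coe, e, Multiset.filter_coe, List.filter_append,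
    List.filter_eq_self.2 (by simpa using hpos), List.filter_eq_nil_iff.2 (by simp), List.append_nil,
    hcoe]

lemma prod_map_filter_ne_zero {M : Type*} [CommMonoid M] (f : ℕ → M) (hf : f 0 = 1)
    (s : Multiset ℕ) : ((s.filter (· ≠ 0)).map f).prod = (s.map f).prod := by
  induction s using Multiset.induction_on with
  | empty => simp
  | cons a s ih =>
    by_cases h : a = 0
    · simp [h, hf, ih]
    · simp [h, ih]

lemma sum_map_filter_ne_zero (f : ℕ → ℕ) (hf : f 0 = 0)
    (s : Multiset ℕ) : ((s.filter (· ≠ 0)).map f).sum = (s.map f).sum := by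
  induction s using Multiset.induction_on with
  | empty => simp
  | cons a s ih =>
    by_cases h : a = 0
    · simp [h, hf, ih]
    · simp [h, ih]

lemma sum_pf_eq {n : ℕ} (P : n.Partition) (f : ℕ → ℕ) (hf : f 0 = 0) :
    ∑ i ∈ range n, f (pf P i) = (P.parts.map f).sum := by
  rw [← map_pf_range, sum_map_filter_ne_zero f hf, Multiset.map_map]
  rfl

lemma sum_pf {n : ℕ} (P : n.Partition) : ∑ i ∈ range n, pf P i = n := by
  simpa [P.parts_sum] using sum_pf_eq P id rfl

lemma pf_injective {n : ℕ} : Function.Injective (pf (n := n)) := by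
  intro P Q h
  refine Nat.Partition.ext ?_
  rw [← map_pf_range P, ← map_pf_range Q, h]

lemma antitone_pf {n : ℕ} (P : n.Partition) : Antitone (pf P) := by
  intro i j hij
  unfold pf
  set l := (P.parts.sort (· ≤ ·)).reverse with hl
  have hs : l.Pairwise (· ≥ ·) := by
    rw [hl, List.pairwise_reverse]
    exact Multiset.pairwise_sort _ _
  simp only [List.getD_eq_getElem?_getD]
  by_cases hj : j < l.length
  · rw [List.getElem?_eq_getElem hj, List.getElem?_eq_getElem (hij.trans_lt hj)]
    rcases hij.eq_or_lt with rfl | h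
    · exact le_rfl
    · exact List.pairwise_iff_getElem.1 hs i j _ hj h
  · simp [List.getElem?_eq_none (not_lt.1 hj)]

lemma sum_truncated_le_of_dominates {n : ℕ} {v g : ℕ → ℕ} (hg : Antitone g)
    (h : Dominates v g) (t : ℕ) : ∑ i ∈ range n, (g i - t) ≤ ∑ i ∈ range n, (v i - t) := by
  obtain ⟨k, hk, h1, h2⟩ : ∃ k ≤ n, (∀ i < k, t ≤ g i) ∧ ∀ i, k ≤ i → i < n → g i ≤ t := by
    induction n with
    | zero => exact ⟨0, le_rfl, by simp, by simp⟩
    | succ n ih =>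
      obtain ⟨k, hk, h1, h2⟩ := ih
      by_cases hn : k = n ∧ t ≤ g n
      · refine ⟨n + 1, le_rfl, fun i hi => hn.2.trans (hg (by omega)), by omega⟩
      · refine ⟨k, by omega, h1, fun i hi hi' => ?_⟩
        by_cases h3 : i = n
        · subst h3
          by_cases h4 : k = i
          · have : ¬ t ≤ g i := fun h => hn ⟨h4, h⟩
            omega
          · exact (hg (show k ≤ i by omega)).trans (h2 k le_rfl (by omega))
        · exact h2 i hi (by omega)
  have e1 : ∑ i ∈ range n, (g i - t) = ∑ i ∈ range k, (g i - t) := by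
    symm
    refine Finset.sum_subset (by simpa using hk) fun i hi hi' => ?_
    simp only [mem_range] at hi hi'
    have := h2 i (by omega) hi
    omega
  have e2 : ∑ i ∈ range k, (g i - t) + k * t = ∑ i ∈ range k, g i := by
    have : k * t = ∑ i ∈ range k, t := by simp
    rw [this, ← Finset.sum_add_distrib]
    exact Finset.sum_congr rfl fun i hi => Nat.sub_add_cancel (h1 i (mem_range.1 hi))
  have e3 : ∑ i ∈ range k, v i ≤ ∑ i ∈ range k, (v i - t) + k * t := by
    have : k * t = ∑ i ∈ range k, t := by simp
    rw [this, ← Finset.sum_add_distrib]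
    exact Finset.sum_le_sum fun i _ => by omega
  have e4 : ∑ i ∈ range k, (v i - t) ≤ ∑ i ∈ range n, (v i - t) :=
    Finset.sum_le_sum_of_subset (by simpa using hk)
  have := h k
  omega

lemma dominates_of_sum_truncated_le {n : ℕ} {v g : ℕ → ℕ} (hv : Antitone v)
    (hg0 : ∀ i, n ≤ i → g i = 0)
    (h : ∀ t, ∑ i ∈ range n, (g i - t) ≤ ∑ i ∈ range n, (v i - t)) : Dominates v g := by
  have key : ∀ k ≤ n, ∑ i ∈ range k, g i ≤ ∑ i ∈ range k, v i := by
    intro k hk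
    have ht := h (v k)
    have e1 : ∑ i ∈ range n, (v i - v k) = ∑ i ∈ range k, (v i - v k) := by
      symm
      refine Finset.sum_subset (by simpa using hk) fun i hi hi' => ?_
      simp only [mem_range] at hi hi'
      have := hv (show k ≤ i by omega)
      omega
    have e2 : ∑ i ∈ range k, (v i - v k) + k * v k = ∑ i ∈ range k, v i := by
      have : k * v k = ∑ i ∈ range k, v k := by simp
      rw [this, ← Finset.sum_add_distrib]
      exact Finset.sum_congr rfl fun i hi => Nat.sub_add_cancel (hv (mem_range.1 hi).le)
    have e3 : ∑ i ∈ range k, g i ≤ ∑ i ∈ range k, (g i - v k) + k * v k := by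
      have : k * v k = ∑ i ∈ range k, v k := by simp
      rw [this, ← Finset.sum_add_distrib]
      exact Finset.sum_le_sum fun i _ => by omega
    have e4 : ∑ i ∈ range k, (g i - v k) ≤ ∑ i ∈ range n, (g i - v k) :=
      Finset.sum_le_sum_of_subset (by simpa using hk)
    omega
  intro k
  rcases le_total k n with hk | hk
  · exact key k hk
  · have e : ∑ i ∈ range k, g i = ∑ i ∈ range n, g i := by
      symm
      refine Finset.sum_subset (by simpa using hk) fun i _ hi' => hg0 i (by simpa using hi')
    rw [e]
    exact (key n le_rfl).trans (Finset.sum_le_sum_of_subset (by simpa using hk))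

lemma dominates_antisymm {a b : ℕ → ℕ} (h1 : Dominates a b) (h2 : Dominates b a) : a = b := by
  funext k
  have h3 := (h1 k).antisymm (h2 k)
  have h4 := (h1 (k + 1)).antisymm (h2 (k + 1))
  rw [Finset.sum_range_succ, Finset.sum_range_succ] at h4
  omega

/-- The matrix `A` has row sums `a`, column sums `b`, and truncated sums at most `V`. -/
def HasBoundedMargins {ι κ : Type*} [Fintype ι] [Fintype κ] (V : ℕ → ℕ) (a : ι → ℕ) (b : κ → ℕ)
    (A : ι × κ → ℕ) : Prop :=
  (∀ i, ∑ j, A (i, j) = a i) ∧ (∀ j, ∑ i, A (i, j) = b j) ∧ ∀ t, ∑ x, (A x - t) ≤ V t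

/-- Some matrix with margins `a`, `b` and truncated sums at most `V` either has a truncated sum
strictly below `V` or is not the only such matrix. -/
def IsSlack {ι κ : Type*} [Fintype ι] [Fintype κ] (V : ℕ → ℕ) (a : ι → ℕ) (b : κ → ℕ) : Prop :=
  ∃ A, HasBoundedMargins V a b A ∧
    ((∃ t, ∑ x, (A x - t) < V t) ∨ ∃ B, B ≠ A ∧ HasBoundedMargins V a b B)

lemma HasBoundedMargins.swap {ι κ : Type*} [Fintype ι] [Fintype κ] {V : ℕ → ℕ} {a : ι → ℕ}
    {b : κ → ℕ} {A : ι × κ → ℕ} (h : HasBoundedMargins V a b A) :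
    HasBoundedMargins V b a (A ∘ Prod.swap) :=
  ⟨h.2.1, h.1, fun t => ((Equiv.prodComm κ ι).sum_comp fun x => A x - t).trans_le (h.2.2 t)⟩

lemma IsSlack.swap {ι κ : Type*} [Fintype ι] [Fintype κ] {V : ℕ → ℕ} {a : ι → ℕ} {b : κ → ℕ}
    (h : IsSlack V a b) : IsSlack V b a := by
  obtain ⟨A, hA, ⟨t, ht⟩ | ⟨B, hB, hB'⟩⟩ := h
  · exact ⟨_, hA.swap, Or.inl ⟨t, ((Equiv.prodComm κ ι).sum_comp fun x => A x - t).trans_lt ht⟩⟩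
  · refine ⟨_, hA.swap, Or.inr ⟨_, fun h => hB ?_, hB'.swap⟩⟩
    funext x
    exact congrFun h x.swap

/-- Move one unit of the matrix `A` within column `j` from row `i` to row `i'`. -/
noncomputable def transfer {ι κ : Type*} (A : ι × κ → ℕ) (i i' : ι) (j : κ) (x : ι × κ) : ℕ :=
  if x = (i, j) then A x - 1 else if x = (i', j) then A x + 1 else A x

lemma sum_truncated_transfer {ι κ : Type*} [Fintype ι] [Fintype κ] (A : ι × κ → ℕ) {i i' : ι}
    {j : κ} (h : A (i', j) < A (i, j)) (t : ℕ) :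
    ∑ x, (transfer A i i' j x - t) + (if t < A (i, j) then 1 else 0) =
      ∑ x, (A x - t) + (if t ≤ A (i', j) then 1 else 0) := by
  have e : ∀ x, (transfer A i i' j x - t) + (if x = (i, j) then if t < A (i, j) then 1 else 0 else 0)
      = (A x - t) + (if x = (i', j) then if t ≤ A (i', j) then 1 else 0 else 0) := by
    intro x
    unfold transfer
    by_cases h1 : x = (i, j)
    · have h2 : x ≠ (i', j) := fun h2 => by rw [← h1, ← h2] at h; exact lt_irrefl _ h
      subst h1
      simp only [if_true, if_neg h2]
      split_ifs <;> omega
    · by_cases h2 : x = (i', j)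
      · subst h2
        simp only [if_true, if_neg h1]
        split_ifs <;> omega
      · simp [h1, h2]
  have := Finset.sum_congr (rfl : (univ : Finset (ι × κ)) = univ) fun x _ => e x
  simpa [Finset.sum_add_distrib] using this

lemma transfer_add {ι κ : Type*} (A : ι × κ → ℕ) {i i' : ι}
    {j : κ} (h : A (i', j) < A (i, j)) (k : ι) (l : κ) :
    transfer A i i' j (k, l) + (if k = i ∧ l = j then 1 else 0) =
      A (k, l) + (if k = i' ∧ l = j then 1 else 0) := by
  unfold transfer
  simp only [Prod.mk.injEq]
  have h3 : i ≠ i' := by rintro rfl; exact lt_irrefl _ h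
  by_cases h1 : k = i ∧ l = j
  · have h2 : ¬ (k = i' ∧ l = j) := fun h2 => h3 (h1.1.symm.trans h2.1)
    rw [if_pos h1, if_pos h1, if_neg h2, h1.1, h1.2]
    omega
  · by_cases h2 : k = i' ∧ l = j <;> simp [h1, h2, h3.symm]

lemma HasBoundedMargins.transfer {ι κ : Type*} [Fintype ι] [Fintype κ] {V : ℕ → ℕ} {a a' : ι → ℕ}
    {b : κ → ℕ} {A : ι × κ → ℕ} (hA : HasBoundedMargins V a b A) {i i' : ι} {j : κ}
    (ha' : ∀ k, a' k + (if k = i then 1 else 0) = a k + (if k = i' then 1 else 0))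
    (h : A (i', j) < A (i, j)) : HasBoundedMargins V a' b (transfer A i i' j) := by
  refine ⟨fun k => ?_, fun l => ?_, fun t => ?_⟩
  · have h1 := Finset.sum_congr (rfl : (univ : Finset κ) = univ) fun l _ => transfer_add A h k l
    simp only [Finset.sum_add_distrib, ite_and, Finset.sum_ite_irrel, Finset.sum_ite_eq',
      mem_univ, if_true, Finset.sum_const_zero, hA.1] at h1
    have := ha' k
    omega
  · have h1 := Finset.sum_congr (rfl : (univ : Finset ι) = univ) fun k _ => transfer_add A h k l
    simp only [Finset.sum_add_distrib, ite_and, Finset.sum_ite_eq',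
      mem_univ, if_true, hA.2.1] at h1
    omega
  · have h1 := sum_truncated_transfer A h t
    have h2 := hA.2.2 t
    split_ifs at h1 <;> omega

lemma HasBoundedMargins.isSlack_of_add_two_le {ι κ : Type*} [Fintype ι] [Fintype κ] {V : ℕ → ℕ}
    {a a' : ι → ℕ} {b : κ → ℕ} {A : ι × κ → ℕ} (hA : HasBoundedMargins V a b A) {i i' : ι}
    (ha' : ∀ k, a' k + (if k = i then 1 else 0) = a k + (if k = i' then 1 else 0))
    (h : a i' + 2 ≤ a i) : IsSlack V a' b := by
  by_cases hj : ∃ j, A (i', j) + 2 ≤ A (i, j)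
  · obtain ⟨j, hj⟩ := hj
    refine ⟨_, hA.transfer ha' (show A (i', j) < A (i, j) by omega), Or.inl ⟨A (i, j) - 1, ?_⟩⟩
    have h1 := sum_truncated_transfer A (show A (i', j) < A (i, j) by omega) (A (i, j) - 1)
    have h2 := hA.2.2 (A (i, j) - 1)
    rw [if_pos (by omega), if_neg (by omega)] at h1
    omega
  · have h1 : ∀ j ∈ (univ : Finset κ),
        A (i, j) ≤ A (i', j) + (if A (i', j) < A (i, j) then 1 else 0) := fun j _ => by
      have : ¬ A (i', j) + 2 ≤ A (i, j) := fun h => hj ⟨j, h⟩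
      split_ifs <;> omega
    have h2 := Finset.sum_le_sum h1
    rw [Finset.sum_add_distrib, hA.1, hA.1, Finset.sum_boole] at h2
    obtain ⟨j₁, h₁, j₂, h₂, hne⟩ := Finset.one_lt_card.1
      (show 1 < (univ.filter fun j => A (i', j) < A (i, j)).card by
        simp only [Nat.cast_id] at h2; omega)
    simp only [mem_filter, mem_univ, true_and] at h₁ h₂
    refine ⟨_, hA.transfer ha' h₁, Or.inr ⟨_, fun e => ?_, hA.transfer ha' h₂⟩⟩
    have h3 := congrFun e (i, j₁)
    have h4 := transfer_add A h₁ i j₁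
    have h5 := transfer_add A h₂ i j₁
    have h6 : i ≠ i' := by rintro rfl; omega
    simp [hne, h6] at h4 h5
    omega

lemma HasBoundedMargins.eq_or_isSlack {ι κ : Type*} [Fintype ι] [LinearOrder ι]
    [LocallyFiniteOrderBot ι] [Fintype κ] {V : ℕ → ℕ} {c : ι → ℕ} (hc : Antitone c)
    {b : κ → ℕ} {a : ι → ℕ} {A : ι × κ → ℕ} (hA : HasBoundedMargins V a b A)
    (hsum : ∑ i, a i = ∑ i, c i) (hle : ∀ k, ∑ i ∈ Iic k, c i ≤ ∑ i ∈ Iic k, a i) :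
    a = c ∨ IsSlack V c b := by
  induction hd : ∑ i, (a i - c i) using Nat.strong_induction_on generalizing a A with
  | _ d ih =>
    by_cases hac : a = c
    · exact Or.inl hac
    right
    have hne : (univ.filter fun i => a i < c i).Nonempty := by
      by_contra hemp
      have h1 : ∀ i ∈ (univ : Finset ι), c i ≤ a i := fun i _ =>
        not_lt.1 fun hi => hemp ⟨i, by simpa using hi⟩
      exact hac (funext fun i => ((Finset.sum_eq_sum_iff_of_le h1).1 hsum.symm i (mem_univ i)).symm)
    obtain ⟨i', hi', hmin⟩ := Finset.exists_min_image _ id hne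
    simp only [mem_filter, mem_univ, true_and, id] at hi' hmin
    have hlt : ∀ k < i', c k ≤ a k := fun k hk =>
      not_lt.1 fun h => not_lt.2 (hmin k h) hk
    obtain ⟨i, hii', hi⟩ : ∃ i < i', c i < a i := by
      by_contra hcon
      refine absurd (hle i') (not_le.2 (Finset.sum_lt_sum (fun k hk => ?_) ⟨i', by simp, hi'⟩))
      rcases (mem_Iic.1 hk).eq_or_lt with rfl | hk
      · exact hi'.le
      · exact not_lt.1 fun h => hcon ⟨k, hk, h⟩
    have hcc := hc hii'.le
    obtain ⟨a', ha'⟩ : ∃ a' : ι → ℕ,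
        ∀ k, a' k + (if k = i then 1 else 0) = a k + (if k = i' then 1 else 0) := by
      refine ⟨fun k => a k + (if k = i' then 1 else 0) - (if k = i then 1 else 0), fun k => ?_⟩
      by_cases hk : k = i
      · subst hk; simp only [if_true]; omega
      · simp [hk]
    have hslack := hA.isSlack_of_add_two_le (fun k => by convert ha' k) (show a i' + 2 ≤ a i by omega)
    obtain ⟨A', hA', -⟩ := id hslack
    have hpre : ∀ s : Finset ι, ∑ k ∈ s, a' k + (if i ∈ s then 1 else 0) =
        ∑ k ∈ s, a k + (if i' ∈ s then 1 else 0) := fun s => by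
      have := Finset.sum_congr (rfl : s = s) fun k _ => ha' k
      simpa [Finset.sum_add_distrib] using this
    have hsum' : ∑ k, a' k = ∑ k, c k := by
      have := hpre univ
      simp only [mem_univ, if_true] at this
      omega
    have hle' : ∀ k, ∑ i ∈ Iic k, c i ≤ ∑ i ∈ Iic k, a' i := fun k => by
      have h1 := hpre (Iic k)
      have h2 := hle k
      simp only [mem_Iic] at h1
      by_cases hik : i ≤ k
      · by_cases hik' : i' ≤ k
        · simp only [hik, hik', if_true] at h1
          omega
        · have := Finset.sum_lt_sum (s := Iic k) (f := c) (g := a)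
            (fun l hl => hlt l ((mem_Iic.1 hl).trans_lt (not_le.1 hik'))) ⟨i, by simpa, hi⟩
          simp only [hik, hik', if_true, if_false] at h1
          omega
      · have hik' : ¬ i' ≤ k := fun h => hik (hii'.le.trans h)
        simp only [hik, hik', if_false] at h1
        omega
    have hlt' : ∑ k, (a' k - c k) < d := by
      rw [← hd]
      refine Finset.sum_lt_sum (fun k _ => ?_) ⟨i, mem_univ i, ?_⟩
      · have := ha' k
        by_cases hk : k = i'
        · subst hk
          simp only [if_true, hii'.ne', if_false] at this
          omega
        · simp only [hk, if_false] at this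
          omega
      · have := ha' i
        simp only [if_true, hii'.ne, if_false] at this
        omega
    rcases ih _ hlt' hA' hsum' hle' rfl with h | h
    · exact h ▸ hslack
    · exact h

lemma sum_Iic_eq_sum_range {M : Type*} [AddCommMonoid M] {n : ℕ} (f : ℕ → M) (k : Fin n) :
    ∑ i ∈ Iic k, f i = ∑ i ∈ range (k + 1), f i := by
  rw [Nat.range_succ_eq_Iic, ← Fin.map_valEmbedding_Iic, Finset.sum_map]
  rfl

lemma sum_Iic_le_sum_Iic_perm {n : ℕ} (σ : Perm (Fin n)) (k : Fin n) :
    ∑ i ∈ Iic k, ((i : ℕ) : ℤ) ≤ ∑ i ∈ Iic k, ((σ i : ℕ) : ℤ) := by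
  have hinj : Function.Injective fun i : Fin n => ((σ i : ℕ) : ℤ) := fun i j h => by
    simpa [Fin.val_inj] using h
  have h := Finset.sum_range_le_sum (s := (Iic k).map ⟨_, hinj⟩) (c := 0) fun x hx => by
    obtain ⟨i, -, rfl⟩ := Finset.mem_map.1 hx
    exact Int.natCast_nonneg _
  rw [Finset.sum_map, Finset.card_map, Fin.card_Iic] at h
  rw [sum_Iic_eq_sum_range (fun i => (i : ℤ))]
  simpa using h

lemma sum_Iic_le_sum_Iic_jtIndex {n : ℕ} (a : ℕ → ℕ) (σ : Perm (Fin n)) (k : Fin n) :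
    ((∑ i ∈ range (k + 1), a i : ℕ) : ℤ) ≤ ∑ i ∈ Iic k, jtIndex a σ i := by
  have := sum_Iic_le_sum_Iic_perm σ k
  simp only [jtIndex, Finset.sum_add_distrib, Finset.sum_sub_distrib]
  rw [← sum_Iic_eq_sum_range, Nat.cast_sum]
  omega

lemma dominates_of_sum_Iic_le {n : ℕ} (P Q : n.Partition)
    (h : ∀ k : Fin n, ∑ i ∈ range (k + 1), pf Q i ≤ ∑ i ∈ range (k + 1), pf P i) :
    Dominates (pf P) (pf Q) := by
  have aux : ∀ (R : n.Partition) {k : ℕ}, n ≤ k → ∑ i ∈ range k, pf R i = n := fun R k hk => by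
    refine Eq.trans (Finset.sum_subset (by simpa using hk) fun i _ hi => ?_).symm (sum_pf R)
    exact pf_eq_zero R (by simpa using hi)
  intro k
  rcases Nat.lt_or_ge k n with hk | hk
  · cases k with
    | zero => simp
    | succ k => exact h ⟨k, by omega⟩
  · rw [aux P hk, aux Q hk]

/-- If the row sums of a matrix are a Jacobi–Trudi index of a partition dominating `P`, then either
they are the parts of `P` or a slack matrix exists. -/
lemma eq_pfin_or_isSlack {n : ℕ} {κ : Type*} [Fintype κ] {V : ℕ → ℕ} {P Q : n.Partition}
    (hd : Dominates (pf Q) (pf P)) (σ : Perm (Fin n)) {a : Fin n → ℕ} {b : κ → ℕ}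
    (ha : ∀ i, (a i : ℤ) = jtIndex (pf Q) σ i) {A : Fin n × κ → ℕ}
    (hA : HasBoundedMargins V a b A) :
    (Q = P ∧ σ = 1 ∧ a = pfin P) ∨ IsSlack V (pfin P) b := by
  have hle : ∀ k : Fin n, ∑ i ∈ range (k + 1), pf Q i ≤ ∑ i ∈ Iic k, a i := fun k => by
    have := sum_Iic_le_sum_Iic_jtIndex (pf Q) σ k
    simp_rw [← ha] at this
    exact_mod_cast this
  have hP : ∀ k : Fin n, ∑ i ∈ Iic k, pfin P i = ∑ i ∈ range (k + 1), pf P i := fun k =>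
    sum_Iic_eq_sum_range (pf P) k
  have hsum : ∑ i, a i = ∑ i, pfin P i := by
    have h1 : ∑ i, pfin P i = n := (Fin.sum_univ_eq_sum_range (pf P) n).trans (sum_pf P)
    have h2 : ∑ i : Fin n, pf Q i = n := (Fin.sum_univ_eq_sum_range (pf Q) n).trans (sum_pf Q)
    have h3 : ∑ i, ((σ i : ℕ) : ℤ) = ∑ i : Fin n, ((i : ℕ) : ℤ) :=
      Equiv.sum_comp σ fun i => ((i : ℕ) : ℤ)
    have h4 : (∑ i, (a i : ℤ)) = ∑ i : Fin n, (pf Q i : ℤ) := by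
      simp_rw [ha, jtIndex, Finset.sum_add_distrib, Finset.sum_sub_distrib, h3]
      omega
    refine Eq.trans ?_ (h2.trans h1.symm)
    exact_mod_cast h4
  rcases hA.eq_or_isSlack (c := pfin P) (fun i j h => antitone_pf P h) hsum
    (fun k => ((hP k).trans_le (hd _)).trans (hle k)) with rfl | h
  · left
    have hQ : Q = P := pf_injective (dominates_antisymm hd
      (dominates_of_sum_Iic_le P Q fun k => (hle k).trans_eq (hP k)))
    subst hQ
    refine ⟨rfl, Equiv.ext fun i => Fin.ext ?_, rfl⟩
    have := ha i
    simp only [pfin, jtIndex] at this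
    rw [Perm.one_apply]
    omega
  · exact Or.inr h

lemma sum_truncated_eq {n : ℕ} {A : Fin n × Fin n → ℕ} {P : n.Partition}
    (h : HasPiSeq (fun i j => A (i, j)) P) (t : ℕ) :
    ∑ x, (A x - t) = ∑ i ∈ range n, (pf P i - t) := by
  rw [sum_pf_eq P (· - t) (Nat.zero_sub t), ← h, sum_map_filter_ne_zero _ (Nat.zero_sub t), entriesM,
    Multiset.map_map]
  rfl

/-- A minimal and π-unique matrix is determined by its margins and truncated sum bounds. -/
lemma hasPiSeq_and_eq_of_hasBoundedMargins {n : ℕ} {lam mu ν : n.Partition} {A : Fin n → Fin n → ℕ}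
    (hmin : ∀ B : Fin n → Fin n → ℕ,
        ((∀ i, ∑ j, B i j = pfin lam i) ∧ (∀ j, ∑ i, B i j = pfin mu j)) →
        ∀ γ : n.Partition, HasPiSeq B γ → Dominates (pf ν) (pf γ) → γ = ν)
    (huniq : ∀ B : Fin n → Fin n → ℕ,
        ((∀ i, ∑ j, B i j = pfin lam i) ∧ (∀ j, ∑ i, B i j = pfin mu j)) →
        HasPiSeq B ν → B = A) {B : Fin n × Fin n → ℕ}
    (hB : HasBoundedMargins (fun t => ∑ i ∈ range n, (pf ν i - t)) (pfin lam) (pfin mu) B) :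
    HasPiSeq (fun i j => B (i, j)) ν ∧ (fun i j => B (i, j)) = A := by
  have hsum : (entriesM fun i j => B (i, j)).sum = n := by
    have h1 : ∑ i, pfin lam i = n := (Fin.sum_univ_eq_sum_range (pf lam) n).trans (sum_pf lam)
    have h2 : ∑ x, B x = n := by
      rw [Fintype.sum_prod_type]
      exact (Finset.sum_congr rfl fun i _ => hB.1 i).trans h1
    exact h2
  have hγ : HasPiSeq (fun i j => B (i, j)) (Nat.Partition.ofSums n _ hsum) := by
    simp [HasPiSeq, Nat.Partition.ofSums]
  have hdom : Dominates (pf ν) (pf (Nat.Partition.ofSums n _ hsum)) :=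
    dominates_of_sum_truncated_le (antitone_pf ν) (fun i => pf_eq_zero _) fun t =>
      (sum_truncated_eq hγ t).symm.trans_le (hB.2.2 t)
  have e := hmin _ ⟨hB.1, hB.2.1⟩ _ hγ hdom
  rw [e] at hγ
  exact ⟨hγ, huniq _ ⟨hB.1, hB.2.1⟩ hγ⟩

lemma eq_of_mem_margins_of_coeff_ne_zero {n : ℕ} {lam mu ν : n.Partition} {A : Fin n → Fin n → ℕ}
    (hmin : ∀ B : Fin n → Fin n → ℕ,
        ((∀ i, ∑ j, B i j = pfin lam i) ∧ (∀ j, ∑ i, B i j = pfin mu j)) →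
        ∀ γ : n.Partition, HasPiSeq B γ → Dominates (pf ν) (pf γ) → γ = ν)
    (huniq : ∀ B : Fin n → Fin n → ℕ,
        ((∀ i, ∑ j, B i j = pfin lam i) ∧ (∀ j, ∑ i, B i j = pfin mu j)) →
        HasPiSeq B ν → B = A) {α β γ : n.Partition} (hα : Dominates (pf α) (pf lam))
    (hβ : Dominates (pf β) (pf mu)) (hγ : Dominates (pf ν) (pf γ)) {σ τ : Perm (Fin n)}
    {T : Fin n × Fin n → ℕ} (hT : T ∈ margins n (jtIndex (pf α) σ) (jtIndex (pf β) τ))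
    (hne : MvPolynomial.coeff (addStaircase n (pf γ))
      ((∏ x, completeHom n (T x)) * alternant n) ≠ 0) :
    (α, β, γ) = (lam, mu, ν) ∧ σ = 1 ∧ τ = 1 ∧ T = fun x => A x.1 x.2 := by
  obtain ⟨-, hrow, hcol⟩ := mem_margins.1 hT
  have hle : ∀ t, ∑ x, (T x - t) ≤ ∑ i ∈ range n, (pf γ i - t) := fun t => by
    have h1 := sum_truncated_le_of_coeff_ne_zero ((univ : Finset (Fin n × Fin n)).val.map T) t
      (addStaircase n (pf γ)) (strictAnti_addStaircase (antitone_pf γ))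
      (by rw [Multiset.map_map]; exact hne)
    rw [Multiset.map_map] at h1
    refine h1.trans_eq ?_
    rw [← Fin.sum_univ_eq_sum_range fun i => pf γ i - t]
    refine Finset.sum_congr rfl fun j _ => ?_
    simp only [addStaircase, Finsupp.equivFunOnFinite_symm_apply_apply]
    omega
  have hgood : HasBoundedMargins (fun t => ∑ i ∈ range n, (pf ν i - t))
      (fun i => ∑ j, T (i, j)) (fun j => ∑ i, T (i, j)) T :=
    ⟨fun _ => rfl, fun _ => rfl, fun t =>
      (hle t).trans (sum_truncated_le_of_dominates (antitone_pf γ) hγ t)⟩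
  have hnot : ¬ IsSlack (fun t => ∑ i ∈ range n, (pf ν i - t)) (pfin lam) (pfin mu) := by
    rintro ⟨B, hB, ⟨t, ht⟩ | ⟨C, hCB, hC⟩⟩
    · exact ht.ne (sum_truncated_eq (hasPiSeq_and_eq_of_hasBoundedMargins hmin huniq hB).1 t)
    · have h := (hasPiSeq_and_eq_of_hasBoundedMargins hmin huniq hC).2.trans
        (hasPiSeq_and_eq_of_hasBoundedMargins hmin huniq hB).2.symm
      exact hCB (funext fun x => congrFun (congrFun h x.1) x.2)
  rcases eq_pfin_or_isSlack hα σ hrow hgood with ⟨rfl, rfl, ha⟩ | hs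
  · rw [ha] at hgood
    rcases eq_pfin_or_isSlack hβ τ hcol hgood.swap with ⟨rfl, rfl, hb⟩ | hs
    · rw [hb] at hgood
      obtain ⟨h1, h2⟩ := hasPiSeq_and_eq_of_hasBoundedMargins hmin huniq hgood
      refine ⟨?_, rfl, rfl, funext fun x => congrFun (congrFun h2 x.1) x.2⟩
      have h3 : Dominates (pf γ) (pf ν) :=
        dominates_of_sum_truncated_le (antitone_pf γ) (fun i => pf_eq_zero ν) fun t =>
          (sum_truncated_eq h1 t).symm.trans_le (hle t)
      rw [pf_injective (dominates_antisymm h3 hγ)]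
    · exact absurd hs.swap hnot
  · obtain ⟨B, hB, -⟩ := id hs
    rcases eq_pfin_or_isSlack hβ τ hcol hB.swap with ⟨-, -, hb⟩ | hs'
    · exact absurd (hb ▸ hs) hnot
    · exact absurd hs'.swap hnot

lemma kron_eq_sum_coeff {n : ℕ} (a b c : ℕ → ℕ) :
    kron n a b c = ∑ σ : Perm (Fin n), ∑ τ : Perm (Fin n),
      ((Perm.sign σ : ℤ) : ℚ) * ((Perm.sign τ : ℤ) : ℚ) *
      ∑ T ∈ margins n (jtIndex a σ) (jtIndex b τ),
        MvPolynomial.coeff (addStaircase n c) ((∏ x, completeHom n (T x)) * alternant n) := by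
  rw [kron_eq]
  refine Finset.sum_congr rfl fun σ _ => Finset.sum_congr rfl fun τ _ => ?_
  exact congrArg _ (Finset.sum_congr rfl fun T hT => sum_sign_card_margins T (mem_margins.1 hT).1 c)

lemma coeff_eq_one_of_hasPiSeq {n : ℕ} {A : Fin n → Fin n → ℕ} {ν : n.Partition}
    (h : HasPiSeq A ν) :
    MvPolynomial.coeff (addStaircase n (pf ν))
      ((∏ x : Fin n × Fin n, completeHom n (A x.1 x.2)) * alternant n) = 1 := by
  have e : ∏ x : Fin n × Fin n, completeHom n (A x.1 x.2) =
      ((Multiset.range n).map fun i => completeHom n (pf ν i)).prod := by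
    trans ((entriesM A).map (completeHom n)).prod
    · rw [entriesM, Multiset.map_map]
      rfl
    · rw [← prod_map_filter_ne_zero _ (completeHom_zero n), h, ← map_pf_range,
        prod_map_filter_ne_zero _ (completeHom_zero n), Multiset.map_map]
      rfl
  rw [e]
  exact coeff_addStaircase_self (antitone_pf ν) (pf_eq_zero ν le_rfl) fun i hi => pf_eq_zero ν hi

/-- if `A ∈ M(lam,mu)` has π-sequence `ν`, is minimal and π-unique, then
`χ^ν` is a minimal component of `χ^lam ⊗ χ^mu`, `k(lam,mu,ν) = 1`, and all other
Kronecker coefficients `k(α,β,γ)` with `α ⊵ lam`, `β ⊵ mu`, `γ ⊴ ν` vanish. -/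
theorem stmt19 (n : ℕ) (lam mu ν : n.Partition) (A : Fin n → Fin n → ℕ)
    (hA : (∀ i, ∑ j, A i j = pfin lam i) ∧ (∀ j, ∑ i, A i j = pfin mu j))
    (hπ : HasPiSeq A ν)
    (hmin : ∀ B : Fin n → Fin n → ℕ,
        ((∀ i, ∑ j, B i j = pfin lam i) ∧ (∀ j, ∑ i, B i j = pfin mu j)) →
        ∀ γ : n.Partition, HasPiSeq B γ → Dominates (pf ν) (pf γ) → γ = ν)
    (huniq : ∀ B : Fin n → Fin n → ℕ,
        ((∀ i, ∑ j, B i j = pfin lam i) ∧ (∀ j, ∑ i, B i j = pfin mu j)) →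
        HasPiSeq B ν → B = A) :
    (∀ γ : n.Partition, Dominates (pf ν) (pf γ) → γ ≠ ν →
        kron n (pf lam) (pf mu) (pf γ) = 0) ∧
    kron n (pf lam) (pf mu) (pf ν) = 1 ∧
    ∀ α β γ : n.Partition, Dominates (pf α) (pf lam) → Dominates (pf β) (pf mu) →
      Dominates (pf ν) (pf γ) → (α, β, γ) ≠ (lam, mu, ν) →
      kron n (pf α) (pf β) (pf γ) = 0 := by
  have zero : ∀ α β γ : n.Partition, Dominates (pf α) (pf lam) → Dominates (pf β) (pf mu) →
      Dominates (pf ν) (pf γ) → (α, β, γ) ≠ (lam, mu, ν) →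
      kron n (pf α) (pf β) (pf γ) = 0 := by
    intro α β γ hα hβ hγ hne
    rw [kron_eq_sum_coeff]
    refine Finset.sum_eq_zero fun σ _ => Finset.sum_eq_zero fun τ _ => ?_
    rw [Finset.sum_eq_zero, mul_zero]
    intro T hT
    by_contra h
    exact hne (eq_of_mem_margins_of_coeff_ne_zero hmin huniq hα hβ hγ hT h).1
  have hrefl : ∀ a : ℕ → ℕ, Dominates a a := fun a k => le_rfl
  refine ⟨fun γ hγ hne => zero lam mu γ (hrefl _) (hrefl _) hγ (by simpa using hne), ?_, zero⟩
  have key := fun σ τ T hT => eq_of_mem_margins_of_coeff_ne_zero (σ := σ) (τ := τ) (T := T)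
    hmin huniq (hrefl (pf lam)) (hrefl (pf mu)) (hrefl (pf ν)) hT
  have hmem : (fun x : Fin n × Fin n => A x.1 x.2) ∈
      margins n (jtIndex (pf lam) 1) (jtIndex (pf mu) 1) := by
    refine mem_margins.2 ⟨?_, fun i => ?_, fun j => ?_⟩
    · rw [Fintype.sum_prod_type]
      exact (Finset.sum_congr rfl fun i _ => hA.1 i).trans
        ((Fin.sum_univ_eq_sum_range (pf lam) n).trans (sum_pf lam))
    · simp [hA.1, jtIndex, pfin]
    · simp [hA.2, jtIndex, pfin]
  rw [kron_eq_sum_coeff, Finset.sum_eq_single 1, Finset.sum_eq_single 1,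
    Finset.sum_eq_single_of_mem _ hmem, coeff_eq_one_of_hasPiSeq hπ]
  · simp
  · intro T hT hne
    by_contra h
    exact hne (key 1 1 T hT h).2.2.2
  · intro τ _ hτ
    rw [Finset.sum_eq_zero, mul_zero]
    intro T hT
    by_contra h
    exact hτ (key 1 τ T hT h).2.2.1
  · simp
  · intro σ _ hσ
    refine Finset.sum_eq_zero fun τ _ => ?_
    rw [Finset.sum_eq_zero, mul_zero]
    intro T hT
    by_contra h
    exact hσ (key σ τ T hT h).2.1
  · simp
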